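/- Let n ≥ 1 and r ≥ 1 be integers, let p, s ≥ 0 be integers, l, m ≥ 1 integers, and 0 ≤ a < 1. Then for the scalar (s = 0) case: ∫_{ℝⁿ} d^n k/(2π)^n ∮_C (i dλ/2π) e^{-λ} · k^{2p} / [(k^{2r} - λ)^l ((1-a)k^{2r} - λ)^m] = (1/(4π)^{n/2}) · Γ((p + n/2)/r) / (r·Γ(n/2)·Γ(l+m)) · F(m, (p+n/2)/r; l+m; a), where C is a contour encircling the positive real axis and F is the Gauss hypergeometric function. -/

import Mathlib

open MeasureTheory

/-- Pochhammer symbol `(x)_k` for a real number. -/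
noncomputable def pochR (x : ℝ) (k : ℕ) : ℝ := ∏ i ∈ Finset.range k, (x + i)

/-- Gauss hypergeometric series `₂F₁(a,b;c;z)` for real arguments. -/
noncomputable def hypR (a b c z : ℝ) : ℝ :=
  ∑' k : ℕ, pochR a k * pochR b k / (pochR c k * (k.factorial : ℝ)) * z ^ k

open Filter Topology

lemma pochR_succ (x : ℝ) (k : ℕ) : pochR x (k + 1) = pochR x k * (x + k) := by
  simp [pochR, Finset.prod_range_succ]

lemma pochR_pos {x : ℝ} (hx : 0 < x) (k : ℕ) : 0 < pochR x k :=
  Finset.prod_pos fun i _ => by positivity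

lemma pochR_nat (N j : ℕ) : pochR ((N : ℝ) + 1) j * N.factorial = (N + j).factorial := by
  induction j with
  | zero => simp [pochR]
  | succ j ih =>
    rw [pochR_succ, ← add_assoc, Nat.factorial_succ]
    push_cast
    rw [← ih]; ring

lemma gamma_add_nat {s : ℝ} (hs : 0 < s) (j : ℕ) :
    Real.Gamma (s + j) = Real.Gamma s * pochR s j := by
  induction j with
  | zero => simp [pochR]
  | succ j ih =>
    rw [pochR_succ]
    push_cast
    rw [← add_assoc, Real.Gamma_add_one (by positivity), ih]; ring

lemma summable_hyp {x y c a : ℝ} (hx : 0 < x) (hy : 0 < y) (hc : 0 < c) (ha0 : 0 ≤ a)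
    (ha1 : a < 1) :
    Summable fun k : ℕ => pochR x k * pochR y k / (pochR c k * (k.factorial : ℝ)) * a ^ k := by
  have key : ∀ u v : ℝ, Tendsto (fun k : ℕ => (u + k) / (v + k)) atTop (𝓝 1) := by
    intro u v
    have := tendsto_add_mul_div_add_mul_atTop_nhds u v (1:ℝ) (d := 1) one_ne_zero
    simpa using this
  have hlim : Tendsto (fun k : ℕ => ((x + k) / (c + k)) * ((y + k) / (1 + k)) * a) atTop (𝓝 a) := by
    simpa using ((key x c).mul (key y 1)).mul_const a
  obtain ⟨q, hq0, hq1⟩ := exists_between ha1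
  refine summable_of_ratio_norm_eventually_le hq1 ?_
  filter_upwards [hlim.eventually_le_const hq0] with k hk
  have hp := pochR_pos hx k
  have hp2 := pochR_pos hy k
  have hp3 := pochR_pos hc k
  have e : pochR x (k+1) * pochR y (k+1) / (pochR c (k+1) * ((k+1).factorial : ℝ)) * a ^ (k+1)
     = ((x + k) / (c + k)) * ((y + k) / (1 + k)) * a *
        (pochR x k * pochR y k / (pochR c k * (k.factorial : ℝ)) * a ^ k) := by
    rw [pochR_succ, pochR_succ, pochR_succ, Nat.factorial_succ, pow_succ]
    push_cast
    field_simp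
    ring
  rw [e, norm_mul, Real.norm_of_nonneg (by positivity)]
  gcongr

lemma hasSum_circle {f : ℕ → ℂ → ℂ} {g : ℂ → ℂ} {c : ℕ → ℝ} {R : ℝ} (hR : 0 ≤ R)
    (hf : ∀ n, ContinuousOn (f n) (Metric.sphere 0 R))
    (hb : ∀ n, ∀ z ∈ Metric.sphere (0:ℂ) R, ‖f n z‖ ≤ c n) (hc : Summable c)
    (hs : ∀ z ∈ Metric.sphere (0:ℂ) R, HasSum (fun n => f n z) (g z)) :
    HasSum (fun n => ∮ z in C(0, R), f n z) (∮ z in C(0, R), g z) := by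
  have h := tendstoUniformlyOn_tsum hc hb
  have h2 := h.tendsto_circleIntegral_of_continuousOn hR
    (Eventually.of_forall fun t => continuousOn_finsetSum t fun i _ => hf i)
  have e : (∮ z in C(0, R), ∑' n, f n z) = ∮ z in C(0, R), g z :=
    circleIntegral.integral_congr hR fun z hz => (hs z hz).tsum_eq
  rw [e] at h2
  refine h2.congr fun t => ?_
  exact circleIntegral.integral_fun_sum fun i _ => (hf i).circleIntegrable hR

lemma sphere_ne {x R : ℝ} (hx : 0 ≤ x) (hR : x < R) {z : ℂ} (hz : R ≤ ‖z‖) : (x : ℂ) - z ≠ 0 := by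
  intro h
  rw [← sub_eq_zero.mp h, Complex.norm_real, Real.norm_of_nonneg hx] at hz
  linarith

lemma contour_pow {x R : ℝ} (hx : 0 ≤ x) (hR : x < R) (N : ℕ) :
    (∮ z in C(0, R), Complex.exp (-z) / ((x : ℂ) - z) ^ (N + 1))
      = -(2 * Real.pi * Complex.I) * Complex.exp (-x) / N.factorial := by
  have hne : ∀ z ∈ Metric.sphere (0:ℂ) R, (x : ℂ) - z ≠ 0 := fun z hz =>
    sphere_ne hx hR (by simpa using hz.ge)
  have hR0 : 0 ≤ R := by linarith
  have hcont : ∀ N : ℕ, ContinuousOn (fun z : ℂ => Complex.exp (-z) / ((x : ℂ) - z) ^ N)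
      (Metric.sphere 0 R) := fun N =>
    ContinuousOn.div (by fun_prop) (by fun_prop) fun z hz => pow_ne_zero _ (hne z hz)
  induction N with
  | zero =>
    have hw : (x : ℂ) ∈ Metric.ball (0:ℂ) R := by simpa [abs_of_nonneg hx] using hR
    have := Complex.circleIntegral_sub_inv_smul_of_differentiable_on_off_countable
      (f := fun z => -Complex.exp (-z)) Set.countable_empty hw (by fun_prop)
      (fun z _ => by fun_prop)
    simp only [smul_eq_mul] at this
    simp only [zero_add, pow_one, Nat.factorial_zero, Nat.cast_one, div_one]
    rw [neg_mul, ← mul_neg, ← this]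
    refine circleIntegral.integral_congr hR0 fun z hz => ?_
    have h1 := hne z hz
    show Complex.exp (-z) / ((x:ℂ) - z) = (z - x)⁻¹ * -Complex.exp (-z)
    rw [← neg_sub (x:ℂ) z, inv_neg]; field_simp
  | succ N ih =>
    have h0 : (∮ z in C(0, R), (-(Complex.exp (-z) / ((x : ℂ) - z) ^ (N + 1))
        + ((N:ℂ) + 1) * (Complex.exp (-z) / ((x : ℂ) - z) ^ (N + 1 + 1)))) = 0 := by
      refine circleIntegral.integral_eq_zero_of_hasDerivWithinAt
        (f := fun z => Complex.exp (-z) / ((x : ℂ) - z) ^ (N + 1)) hR0 fun z hz => ?_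
      have h1 := hne z hz
      have hd1 : HasDerivAt (fun z : ℂ => Complex.exp (-z)) (Complex.exp (-z) * -1) z :=
        (hasDerivAt_neg z).cexp
      have hd2 : HasDerivAt (fun z : ℂ => ((x : ℂ) - z) ^ (N+1))
        (((N + 1 : ℕ) : ℂ) * ((x : ℂ) - z) ^ N * -1) z := by
        exact ((hasDerivAt_id z).const_sub (x:ℂ)).pow (N+1)
      refine ((hd1.div hd2 (pow_ne_zero _ h1)).congr_deriv ?_).hasDerivWithinAt
      push_cast
      field_simp
      ring
    rw [circleIntegral.integral_add, circleIntegral.integral_const_mul] at h0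
    · have h3 : (∮ z in C(0, R), -(Complex.exp (-z) / ((x : ℂ) - z) ^ (N + 1)))
        = - ∮ z in C(0, R), (Complex.exp (-z) / ((x : ℂ) - z) ^ (N + 1)) := by
        simpa using circleIntegral.integral_const_mul (-1)
          (fun z => Complex.exp (-z) / ((x : ℂ) - z) ^ (N + 1)) 0 R
      rw [h3, ih] at h0
      have hN : (N : ℂ) + 1 ≠ 0 := by exact_mod_cast Nat.succ_ne_zero N
      have hNf : (N.factorial : ℂ) ≠ 0 := by exact_mod_cast N.factorial_ne_zero
      rw [Nat.factorial_succ]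
      push_cast
      apply mul_left_cancel₀ hN
      rw [eq_of_sub_eq_zero (a := _ * _) (b := _) (by rw [sub_eq_neg_add]; exact h0)]
      field_simp
    · exact ((hcont _).neg).circleIntegrable hR0
    · exact ((hcont _).const_smul ((N:ℂ)+1)).circleIntegrable hR0

lemma contour_eval {x a : ℝ} (hx : 0 ≤ x) (ha0 : 0 ≤ a) (ha1 : a < 1) (L M : ℕ) :
    HasSum (fun j : ℕ => ((j + M).choose M : ℂ) * (a * x) ^ j *
        (-(2 * Real.pi * Complex.I) * Complex.exp (-x) / (L + M + 1 + j).factorial))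
      (∮ z in C(0, x + 1), Complex.exp (-z) / ((x : ℂ) - z) ^ (L + 1)
        / (((1 - a) * x : ℝ) - z) ^ (M + 1)) := by
  set y : ℝ := (1 - a) * x with hy
  have hy0 : 0 ≤ y := mul_nonneg (by linarith) hx
  have hyx : y ≤ x := by nlinarith
  have hdef : (∮ z in C(0, 2 * x + 1), Complex.exp (-z) / ((x : ℂ) - z) ^ (L + 1)
        / ((y : ℂ) - z) ^ (M + 1)) = (∮ z in C(0, x + 1), Complex.exp (-z) / ((x : ℂ) - z) ^ (L + 1)
        / ((y : ℂ) - z) ^ (M + 1)) := by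
    have hdiff : ∀ z : ℂ, x + 1 ≤ ‖z‖ → DifferentiableAt ℂ (fun z : ℂ =>
        Complex.exp (-z) / ((x : ℂ) - z) ^ (L + 1) / ((y : ℂ) - z) ^ (M + 1)) z := by
      intro z hz1
      have h1 := pow_ne_zero (L + 1) (sphere_ne hx (lt_add_one x) hz1)
      have h2 := pow_ne_zero (M + 1) (sphere_ne hy0 (by linarith) hz1)
      have d0 : DifferentiableAt ℂ (fun z : ℂ => Complex.exp (-z)) z := by fun_prop
      have d1 : DifferentiableAt ℂ (fun z : ℂ => ((x : ℂ) - z) ^ (L + 1)) z := by fun_prop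
      have d2 : DifferentiableAt ℂ (fun z : ℂ => ((y : ℂ) - z) ^ (M + 1)) z := by fun_prop
      exact (d0.fun_div d1 h1).fun_div d2 h2
    refine Complex.circleIntegral_eq_of_differentiable_on_annulus_off_countable (by linarith)
      (by linarith) Set.countable_empty ?_ ?_
    · intro z hz
      have hz1 : x + 1 ≤ ‖z‖ := by simpa using hz.2
      exact (hdiff z hz1).continuousAt.continuousWithinAt
    · intro z hz
      have hz1 : x + 1 ≤ ‖z‖ := by
        have := hz.1.2
        simp at this
        exact this.le
      exact hdiff z hz1
  rw [← hdef]
  set R : ℝ := 2 * x + 1 with hR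
  have hxR : x < R := by linarith
  have hne : ∀ z ∈ Metric.sphere (0:ℂ) R, (x : ℂ) - z ≠ 0 := fun z hz =>
    sphere_ne hx hxR (by simpa using hz.ge)
  have hney : ∀ z ∈ Metric.sphere (0:ℂ) R, (y : ℂ) - z ≠ 0 := fun z hz =>
    sphere_ne hy0 (hyx.trans_lt hxR) (by simpa using hz.ge)
  have hR0 : 0 ≤ R := by linarith
  have hcont : ContinuousOn (fun z : ℂ => Complex.exp (-z) / ((x : ℂ) - z) ^ (L + M + 1 + 1))
      (Metric.sphere 0 R) :=
    ContinuousOn.div (by fun_prop) (by fun_prop) fun z hz => pow_ne_zero _ (hne z hz)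
  obtain ⟨K, hK⟩ := (isCompact_sphere (0:ℂ) R).exists_bound_of_continuousOn hcont
  have hq : ∀ z ∈ Metric.sphere (0:ℂ) R, ‖((a * x : ℝ) : ℂ) / ((x:ℂ) - z)‖ ≤ a := by
    intro z hz
    have hz' : ‖z‖ = R := by simpa using hz
    have h1 : x + 1 ≤ ‖(x:ℂ) - z‖ := by
      have := norm_sub_norm_le z (x:ℂ)
      rw [norm_sub_rev, hz', Complex.norm_real, Real.norm_of_nonneg hx] at this
      linarith
    rw [norm_div, Complex.norm_real, Real.norm_of_nonneg (by positivity)]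
    rw [div_le_iff₀ (by linarith)]
    gcongr
    linarith
  have hmain := hasSum_circle (R := R)
    (f := fun j z => (Complex.exp (-z) / ((x : ℂ) - z) ^ (L + M + 1 + 1)) *
      (((j + M).choose M : ℂ) * (((a * x : ℝ) : ℂ) / ((x:ℂ) - z)) ^ j))
    (g := fun z => Complex.exp (-z) / ((x : ℂ) - z) ^ (L + 1) / ((y : ℂ) - z) ^ (M + 1))
    (c := fun j => K * (((j + M).choose M : ℝ) * a ^ j)) hR0 ?_ ?_ ?_ ?_
  · refine hmain.congr_fun ?_ 
    intro j
    have := contour_pow hx hxR (L + M + 1 + j)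
    rw [← this, ← circleIntegral.integral_const_mul]
    refine circleIntegral.integral_congr hR0 fun z hz => ?_
    have h1 := hne z hz
    push_cast
    rw [div_pow, show L + M + 1 + j + 1 = L + M + 1 + 1 + j by ring, pow_add _ (L+M+1+1) j]
    field_simp
  · intro j
    refine hcont.mul (continuousOn_const.mul ((ContinuousOn.div (by fun_prop) (by fun_prop) hne).pow _))
  · intro j z hz
    rw [norm_mul, norm_mul, norm_pow]
    have := hq z hz
    have h2 := hK z hz
    have h3 : 0 ≤ K := (norm_nonneg _).trans h2
    rw [Complex.norm_natCast]
    gcongr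
  · exact (summable_choose_mul_geometric_of_norm_lt_one M
      (by rwa [Real.norm_of_nonneg ha0])).mul_left K
  · intro z hz
    have h1 := hne z hz
    have h2 := hney z hz
    have := (hasSum_choose_mul_geometric_of_norm_lt_one M ((hq z hz).trans_lt ha1)).mul_left
      (Complex.exp (-z) / ((x : ℂ) - z) ^ (L + M + 1 + 1))
    convert! this using 1
    have e : 1 - ((a * x : ℝ) : ℂ) / ((x:ℂ) - z) = ((y:ℂ) - z) / ((x:ℂ) - z) := by
      rw [hy]; push_cast; field_simp; ring
    rw [e, div_pow, show L + M + 1 + 1 = (L + 1) + (M + 1) by ring, pow_add _ (L+1) (M+1)]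
    field_simp

lemma radial_integrable {n r : ℕ} (hn : 1 ≤ n) (hr : 1 ≤ r) (e : ℕ) :
    Integrable (fun k : EuclideanSpace ℝ (Fin n) => ‖k‖ ^ e * Real.exp (-‖k‖ ^ (2 * r))) ∧
    ∫ k : EuclideanSpace ℝ (Fin n), ‖k‖ ^ e * Real.exp (-‖k‖ ^ (2 * r))
      = √Real.pi ^ n / (r * Real.Gamma ((n : ℝ) / 2)) *
        Real.Gamma (((e : ℝ) + n) / (2 * r)) := by
  have : Nonempty (Fin n) := ⟨⟨0, hn⟩⟩
  have hr' : (0 : ℝ) < r := by exact_mod_cast hr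
  have hn' : (0 : ℝ) < n := by exact_mod_cast hn
  have hf : Module.finrank ℝ (EuclideanSpace ℝ (Fin n)) = n := by simp
  have hn1 : ((n - 1 : ℕ) : ℝ) = n - 1 := by rw [Nat.cast_sub hn]; simp
  have heq : Set.EqOn (fun y : ℝ => y ^ ((e : ℝ) + n - 1) * Real.exp (-y ^ (2 * (r : ℝ))))
      (fun y : ℝ => y ^ (n - 1) • (y ^ e * Real.exp (-y ^ (2 * r)))) (Set.Ioi 0) := by
    intro y hy
    have hy : 0 < y := hy
    have e1 : y ^ ((e : ℝ) + n - 1) = y ^ (n - 1) * y ^ e := by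
      rw [← pow_add, ← Real.rpow_natCast]
      push_cast
      rw [hn1]; congr 1; ring
    have e2 : y ^ (2 * (r : ℝ)) = y ^ (2 * r) := by
      rw [← Real.rpow_natCast]; push_cast; rfl
    simp only [smul_eq_mul]
    rw [e1, e2]; ring
  have he : (-1 : ℝ) < (e : ℝ) + n - 1 := by
    have : (0 : ℝ) ≤ e := by positivity
    linarith
  constructor
  · refine (integrable_fun_norm_addHaar volume
      (f := fun y : ℝ => y ^ e * Real.exp (-y ^ (2 * r)))).2 ?_
    rw [hf]
    exact (integrableOn_rpow_mul_exp_neg_rpow he (by positivity)).congr_fun heq measurableSet_Ioi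
  · rw [integral_fun_norm_addHaar volume (fun y : ℝ => y ^ e * Real.exp (-y ^ (2 * r))), hf,
      ← setIntegral_congr_fun measurableSet_Ioi heq,
      integral_rpow_mul_exp_neg_rpow (by positivity) he, Measure.real,
      EuclideanSpace.volume_ball, Fintype.card_fin]
    have hG : 0 < Real.Gamma ((n:ℝ)/2) := Real.Gamma_pos_of_pos (by positivity)
    rw [Real.Gamma_add_one (by positivity), ENNReal.ofReal_one, one_pow, one_mul,
      ENNReal.toReal_ofReal (by positivity), nsmul_eq_mul, smul_eq_mul, sub_add_cancel]
    field_simp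

/-- The master integral in the DWSG-coefficient computation (scalar case `s = 0`):
`∫ d^n k/(2π)^n ∮_C (i dλ/2π) e^{-λ} k^{2p} / [(k^{2r}-λ)^l ((1-a)k^{2r}-λ)^m]
  = (4π)^{-n/2} Γ((p+n/2)/r) / (r Γ(n/2) Γ(l+m)) · F(m,(p+n/2)/r;l+m;a)`,
where for each `k` the contour is realized as a circle of radius `‖k‖^{2r}+1` about the
origin, which encircles both poles `k^{2r}` and `(1-a)k^{2r}` lying on the nonnegative
real axis. -/
theorem master_integral (n r p l m : ℕ) (hn : 1 ≤ n) (hr : 1 ≤ r) (hl : 1 ≤ l) (hm : 1 ≤ m)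
    (a : ℝ) (ha0 : 0 ≤ a) (ha1 : a < 1) :
    (∫ k : EuclideanSpace ℝ (Fin n),
        (((2 * Real.pi) ^ n : ℝ) : ℂ)⁻¹ *
          (∮ lam in C(0, ‖k‖ ^ (2 * r) + 1),
            Complex.I / (2 * Real.pi) * Complex.exp (-lam) * ((‖k‖ ^ (2 * p) : ℝ) : ℂ) /
              (((‖k‖ ^ (2 * r) : ℝ) : ℂ) - lam) ^ l /
              ((((1 - a) * ‖k‖ ^ (2 * r) : ℝ) : ℂ) - lam) ^ m))
      = (((4 * Real.pi) ^ ((n : ℝ) / 2))⁻¹ *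
          (Real.Gamma (((p : ℝ) + n / 2) / r) /
            (r * Real.Gamma ((n : ℝ) / 2) * Real.Gamma ((l : ℝ) + m))) *
          hypR m (((p : ℝ) + n / 2) / r) ((l : ℝ) + m) a : ℝ) := by
  obtain ⟨L, rfl⟩ := Nat.exists_eq_add_of_le' hl
  obtain ⟨M, rfl⟩ := Nat.exists_eq_add_of_le' hm
  have hr' : (0 : ℝ) < r := by exact_mod_cast hr
  have hn' : (0 : ℝ) < n := by exact_mod_cast hn
  set s : ℝ := ((p : ℝ) + n / 2) / r with hs
  have hs0 : 0 < s := by positivity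
  set F : ℕ → EuclideanSpace ℝ (Fin n) → ℝ := fun j k =>
    (((2 * Real.pi) ^ n)⁻¹ * ((j + M).choose M / (L + M + 1 + j).factorial * a ^ j)) *
      (‖k‖ ^ (2 * p + 2 * r * j) * Real.exp (-‖k‖ ^ (2 * r))) with hF
  have hpt : ∀ k : EuclideanSpace ℝ (Fin n), HasSum (fun j => ((F j k : ℝ) : ℂ))
      ((((2 * Real.pi) ^ n : ℝ) : ℂ)⁻¹ *
          (∮ lam in C(0, ‖k‖ ^ (2 * r) + 1),
            Complex.I / (2 * Real.pi) * Complex.exp (-lam) * ((‖k‖ ^ (2 * p) : ℝ) : ℂ) /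
              (((‖k‖ ^ (2 * r) : ℝ) : ℂ) - lam) ^ (L + 1) /
              ((((1 - a) * ‖k‖ ^ (2 * r) : ℝ) : ℂ) - lam) ^ (M + 1))) := by
    intro k
    have h := ((contour_eval (x := ‖k‖ ^ (2 * r)) (by positivity) ha0 ha1 L M).mul_left
      (Complex.I / (2 * Real.pi) * ((‖k‖ ^ (2 * p) : ℝ) : ℂ))).mul_left
      ((((2 * Real.pi) ^ n : ℝ) : ℂ)⁻¹)
    rw [← circleIntegral.integral_const_mul] at h
    have hpi : (Real.pi : ℂ) ≠ 0 := by exact_mod_cast Real.pi_ne_zero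
    convert! h using 1
    · funext j
      simp only [hF]
      push_cast
      have hfac : ((L + M + 1 + j).factorial : ℂ) ≠ 0 := by
        exact_mod_cast Nat.factorial_ne_zero _
      rw [pow_add, pow_mul _ (2 * r) j, mul_pow (a:ℂ)]
      field_simp
      rw [Complex.I_sq]; ring
    · congr 2
      funext z
      ring
  have hint : ∀ j, Integrable (F j) := fun j =>
    (radial_integrable hn hr (2 * p + 2 * r * j)).1.const_mul _
  have hval : ∀ j, ∫ k, F j k = (((4 * Real.pi) ^ ((n : ℝ) / 2))⁻¹ *
          (Real.Gamma s / (r * Real.Gamma ((n : ℝ) / 2) *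
            Real.Gamma (((L + 1 : ℕ) : ℝ) + (M + 1 : ℕ))))) *
      (pochR (M + 1 : ℕ) j * pochR s j / (pochR (((L + 1 : ℕ) : ℝ) + (M + 1 : ℕ)) j *
        (j.factorial : ℝ)) * a ^ j) := by
    intro j
    simp only [hF]
    rw [integral_const_mul, (radial_integrable hn hr (2 * p + 2 * r * j)).2]
    have e1 : ((2 * p + 2 * r * j : ℕ) + n : ℝ) / (2 * r) = s + j := by
      rw [hs]; push_cast; field_simp; ring
    have e2 : (((L + 1 : ℕ) : ℝ) + (M + 1 : ℕ)) = ((L + M + 1 : ℕ) : ℝ) + 1 := by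
      push_cast; ring
    have e3 : ((4 * Real.pi) ^ ((n : ℝ) / 2))⁻¹ = √Real.pi ^ n / (2 * Real.pi) ^ n := by
      have : (4 * Real.pi) ^ ((n : ℝ) / 2) = (2 * √Real.pi) ^ n := by
        rw [show 4 * Real.pi = (2 * √Real.pi) ^ (2:ℝ) by
          rw [Real.rpow_two, mul_pow, Real.sq_sqrt Real.pi_pos.le]; norm_num,
          ← Real.rpow_mul (by positivity), ← Real.rpow_natCast]
        congr 1; ring
      rw [this, ← div_pow, ← inv_pow]
      congr 1
      have := Real.sq_sqrt Real.pi_pos.le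
      have h0 : 0 < √Real.pi := Real.sqrt_pos.2 Real.pi_pos
      field_simp
      linarith
    rw [e1, e2, e3, gamma_add_nat hs0, Real.Gamma_nat_eq_factorial]
    have h1 := pochR_nat (L + M + 1) j
    have h2 : pochR ((M + 1 : ℕ) : ℝ) j = (j + M).choose M * j.factorial := by
      have h := pochR_nat M j
      have hc : (((j + M).choose M * M.factorial * j.factorial : ℕ) : ℝ) = (M + j).factorial := by
        rw [mul_right_comm, Nat.add_choose_mul_factorial_mul_factorial, add_comm]
      have hM : (M.factorial : ℝ) ≠ 0 := by exact_mod_cast Nat.factorial_ne_zero _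
      apply mul_right_cancel₀ hM
      push_cast at hc ⊢
      rw [h, ← hc]; ring
    have hG : 0 < Real.Gamma ((n:ℝ)/2) := Real.Gamma_pos_of_pos (by positivity)
    have hp := pochR_pos (x := ((L + M + 1 : ℕ) : ℝ) + 1) (by positivity) j
    rw [h2, ← h1]
    field_simp
  have hsumm := (summable_hyp (x := ((M + 1 : ℕ) : ℝ)) (y := s)
    (c := ((L + 1 : ℕ) : ℝ) + (M + 1 : ℕ)) (by positivity) hs0 (by positivity) ha0 ha1).mul_left
      (((4 * Real.pi) ^ ((n : ℝ) / 2))⁻¹ *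
          (Real.Gamma s / (r * Real.Gamma ((n : ℝ) / 2) *
            Real.Gamma (((L + 1 : ℕ) : ℝ) + (M + 1 : ℕ)))))
  have hnorm : ∀ j k, ‖F j k‖ = F j k := fun j k => Real.norm_of_nonneg (by
    simp only [hF]; positivity)
  have hfin := hasSum_integral_of_summable_integral_norm hint (by
    simp only [hnorm, hval]; exact hsumm)
  simp only [hval] at hfin
  have hI : ∀ k, ((((2 * Real.pi) ^ n : ℝ) : ℂ)⁻¹ *
          (∮ lam in C(0, ‖k‖ ^ (2 * r) + 1),
            Complex.I / (2 * Real.pi) * Complex.exp (-lam) * ((‖k‖ ^ (2 * p) : ℝ) : ℂ) /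
              (((‖k‖ ^ (2 * r) : ℝ) : ℂ) - lam) ^ (L + 1) /
              ((((1 - a) * ‖k‖ ^ (2 * r) : ℝ) : ℂ) - lam) ^ (M + 1)))
      = ((∑' j, F j k : ℝ) : ℂ) := fun k => by
    rw [Complex.ofReal_tsum]; exact (hpt k).tsum_eq.symm
  simp only [hI]
  rw [integral_complex_ofReal, ← hfin.tsum_eq, tsum_mul_left]
  rfl
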